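/- In the chain-plus-loops graph Γ: let r be an integer with 1 ≤ r ≤ g − a − 2 and let D' be an effective divisor of degree a + 2r − 1 supported on Γ₀ with rk_Γ(D') ≥ r. Then there exist effective divisors E and E' of degree a − 1 supported on Γ₀ such that D' is linearly equivalent on Γ₀ both to 2(v_{a+1} + ⋯ + v_{a+r−1} + v_g) + E and to 2(v_{a+1} + ⋯ + v_{a+r−1} + v_{g−1}) + E' (for r = 1 the doubled sums are just 2v_g and 2v_{g−1} respectively). -/

import Mathlib

noncomputable section

/-- The star with `n` rays of radius `r` in the complex plane:
`{ z ∈ ℂ : z = t·e^{2πik/n}, t ∈ [0,r], k ∈ ℤ }`. -/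
def starSet (n : ℕ) (r : ℝ) : Set ℂ :=
  {z | ∃ t ∈ Set.Icc (0 : ℝ) r, ∃ k : ℤ,
    z = (t : ℂ) * Complex.exp (2 * (Real.pi : ℂ) * Complex.I * (k : ℂ) / (n : ℂ))}

/-- `P` has a neighbourhood isometric to a star with `n` rays of some radius `r > 0`,
with `P` corresponding to `0`. -/
def HasStarNbhd (Γ : Type*) [MetricSpace Γ] (P : Γ) (n : ℕ) : Prop :=
  ∃ r > (0 : ℝ), ∃ U ∈ nhds P, ∃ φ : Γ → ℂ,
    φ P = 0 ∧ φ '' U = starSet n r ∧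
    ∀ x ∈ U, ∀ y ∈ U, dist (φ x) (φ y) = dist x y

/-- A metric graph: a compact connected metric space in which every point has a
neighbourhood isometric to a star with `n ≥ 1` rays. -/
def IsMetricGraph (Γ : Type*) [MetricSpace Γ] : Prop :=
  CompactSpace Γ ∧ ConnectedSpace Γ ∧ ∀ P : Γ, ∃ n : ℕ, 1 ≤ n ∧ HasStarNbhd Γ P n

/-- The valence of a point: the number of rays of a star neighbourhood. -/
noncomputable def valence (Γ : Type*) [MetricSpace Γ] (P : Γ) : ℕ :=
  sInf {n : ℕ | 1 ≤ n ∧ HasStarNbhd Γ P n}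

/-- A vertex is a point of valence different from `2`. -/
def IsVertex (Γ : Type*) [MetricSpace Γ] (P : Γ) : Prop := valence Γ P ≠ 2

/-- The genus of a metric graph: `#edges - #vertices + 1`, the edges being the connected
components of the complement of the vertex set. -/
noncomputable def graphGenus (Γ : Type*) [MetricSpace Γ] : ℤ :=
  (Nat.card (ConnectedComponents {P : Γ // ¬ IsVertex Γ P}) : ℤ)
    - (Nat.card {P : Γ // IsVertex Γ P} : ℤ) + 1

/-- A divisor on `Γ` : a finitely supported formal `ℤ`-linear combination of points. -/
abbrev Divisor (Γ : Type*) : Type _ := Γ →₀ ℤ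

/-- The degree of a divisor. -/
def divDeg {Γ : Type*} (D : Divisor Γ) : ℤ := D.sum fun _ n => n

/-- A divisor is effective if all its coefficients are nonnegative. -/
def Effective {Γ : Type*} (D : Divisor Γ) : Prop := ∀ P : Γ, 0 ≤ D P

/-- An arc based at `P` : an isometric parametrization of a segment emanating from `P`. -/
def IsArcAt {Γ : Type*} [MetricSpace Γ] (P : Γ) (τ : ℝ → Γ) : Prop :=
  τ 0 = P ∧ ∃ a > (0 : ℝ), ∀ s ∈ Set.Icc (0 : ℝ) a, ∀ t ∈ Set.Icc (0 : ℝ) a,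
    dist (τ s) (τ t) = |s - t|

/-- Two arcs are equivalent (define the same tangent direction) when they agree near `0`. -/
def ArcEquiv {Γ : Type*} (τ τ' : ℝ → Γ) : Prop :=
  ∃ ε > (0 : ℝ), ∀ t ∈ Set.Icc (0 : ℝ) ε, τ t = τ' t

/-- `f` has (one-sided) slope `s` along the arc `τ`. -/
def HasSlopeAlong {Γ : Type*} (f : Γ → ℝ) (τ : ℝ → Γ) (s : ℤ) : Prop :=
  ∃ ε > (0 : ℝ), ∀ t ∈ Set.Icc (0 : ℝ) ε, f (τ t) = f (τ 0) + (s : ℝ) * t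

/-- A rational function on a metric graph: continuous and piecewise affine with
integer slopes, i.e. having an integer slope along every arc. -/
def IsRational (Γ : Type*) [MetricSpace Γ] (f : Γ → ℝ) : Prop :=
  Continuous f ∧ ∀ (P : Γ) (τ : ℝ → Γ), IsArcAt P τ → ∃ s : ℤ, HasSlopeAlong f τ s

/-- `div f` has coefficient `m` at `P`: the sum of the slopes of `f` in all tangent
directions emanating from `P` equals `m`. -/
def HasOrderAt (Γ : Type*) [MetricSpace Γ] (f : Γ → ℝ) (P : Γ) (m : ℤ) : Prop :=
  ∃ (n : ℕ) (τ : Fin n → ℝ → Γ) (s : Fin n → ℤ),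
    (∀ i, IsArcAt P (τ i)) ∧
    Pairwise (fun i j => ¬ ArcEquiv (τ i) (τ j)) ∧
    (∀ σ : ℝ → Γ, IsArcAt P σ → ∃ i, ArcEquiv σ (τ i)) ∧
    (∀ i, HasSlopeAlong f (τ i) (s i)) ∧
    m = ∑ i, s i

/-- Linear equivalence of divisors: `D₂ - D₁ = div f` for some rational function `f`. -/
def LinEquiv (Γ : Type*) [MetricSpace Γ] (D₁ D₂ : Divisor Γ) : Prop :=
  ∃ f : Γ → ℝ, IsRational Γ f ∧ ∀ P : Γ, HasOrderAt Γ f P (D₂ P - D₁ P)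

/-- `D` is linearly equivalent to an effective divisor. -/
def EquivEffective (Γ : Type*) [MetricSpace Γ] (D : Divisor Γ) : Prop :=
  ∃ D' : Divisor Γ, Effective D' ∧ LinEquiv Γ D D'

/-- For every effective divisor `E` of degree `r`, `D - E` is linearly equivalent to an
effective divisor. -/
def RankGE (Γ : Type*) [MetricSpace Γ] (D : Divisor Γ) (r : ℕ) : Prop :=
  ∀ E : Divisor Γ, Effective E → divDeg E = (r : ℤ) → EquivEffective Γ (D - E)

/-- The rank of a divisor: `-1` if `D` is not equivalent to an effective divisor, and
otherwise the largest `r ≥ 0` such that `D - E` is equivalent to an effective divisor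
for every effective `E` of degree `r`. -/
noncomputable def divRank (Γ : Type*) [MetricSpace Γ] (D : Divisor Γ) : ℤ :=
  sSup (insert (-1) {n : ℤ | ∃ r : ℕ, n = (r : ℤ) ∧ RankGE Γ D r})

/-- The arc `τ` immediately leaves the set `X`. -/
def ArcLeaves {Γ : Type*} (X : Set Γ) (τ : ℝ → Γ) : Prop :=
  ∃ ε > (0 : ℝ), ∀ t ∈ Set.Ioc (0 : ℝ) ε, τ t ∉ X

/-- `P` is a non-saturated boundary point of `X` with respect to `D` : the number of
tangent directions at `P` leaving `X` is strictly greater than `D P`. -/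
def NonSaturated (Γ : Type*) [MetricSpace Γ] (D : Divisor Γ) (X : Set Γ) (P : Γ) : Prop :=
  P ∈ frontier X ∧ ∃ (n : ℕ) (τ : Fin n → ℝ → Γ),
    (∀ i, IsArcAt P (τ i)) ∧ (∀ i, ArcLeaves X (τ i)) ∧
    Pairwise (fun i j => ¬ ArcEquiv (τ i) (τ j)) ∧ D P < (n : ℤ)

/-- `D` is `P₀`-reduced. -/
def IsReducedDivisor (Γ : Type*) [MetricSpace Γ] (D : Divisor Γ) (P₀ : Γ) : Prop :=
  (∀ P : Γ, P ≠ P₀ → 0 ≤ D P) ∧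
  ∀ X : Set Γ, IsClosed X → X.Nonempty → P₀ ∉ X → ∃ P, NonSaturated Γ D X P

/-- The restriction of a divisor on `Γ` to a divisor on a subset `S` (with the induced
metric); divisors supported on `S` are identified with divisors on `S` this way. -/
noncomputable def DivRestrict {Γ : Type*} (S : Set Γ) (D : Divisor Γ) : Divisor ↥S :=
  Finsupp.comapDomain Subtype.val D Subtype.coe_injective.injOn

/-- Linear equivalence computed on the subgraph `S` of `Γ`. -/
def LinEquivOn {Γ : Type*} [MetricSpace Γ] (S : Set Γ) (D₁ D₂ : Divisor Γ) : Prop :=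
  LinEquiv ↥S (DivRestrict S D₁) (DivRestrict S D₂)

/-- The rank computed on the subgraph `S` of `Γ`. -/
noncomputable def divRankOn {Γ : Type*} [MetricSpace Γ] (S : Set Γ) (D : Divisor Γ) : ℤ :=
  divRank ↥S (DivRestrict S D)

/-- A free divisor: effective, of rank at least one, and removing any point decreases
the rank. -/
def IsFreeDivisor (Γ : Type*) [MetricSpace Γ] (D : Divisor Γ) : Prop :=
  Effective D ∧ 1 ≤ divRank Γ D ∧
  ∀ P : Γ, divRank Γ (D - Finsupp.single P 1) < divRank Γ D

/-- The canonical divisor `K_Γ = Σ_P (val(P) - 2)·P`. -/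
def IsCanonical (Γ : Type*) [MetricSpace Γ] (K : Divisor Γ) : Prop :=
  ∀ P : Γ, K P = (valence Γ P : ℤ) - 2

/-- A very special divisor: effective with `rk(D) > 0` and `rk(K_Γ - D) > 0`. -/
def VerySpecial (Γ : Type*) [MetricSpace Γ] (D : Divisor Γ) : Prop :=
  Effective D ∧ 0 < divRank Γ D ∧
  ∃ K : Divisor Γ, IsCanonical Γ K ∧ 0 < divRank Γ (K - D)

/-- `φ` is an `L`-periodic locally isometric parametrization of the circle `S ⊆ Γ`
of circumference `L`. -/
def CircleParam {Γ : Type*} [MetricSpace Γ] (S : Set Γ) (L : ℝ) (φ : ℝ → Γ) : Prop :=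
  0 < L ∧ (∀ t : ℝ, φ (t + L) = φ t) ∧ Set.range φ = S ∧
  ∀ s t : ℝ, |s - t| ≤ L / 2 → dist (φ s) (φ t) = |s - t|

/-- `S` is a metric circle inside `Γ`. -/
def IsCircleSet {Γ : Type*} [MetricSpace Γ] (S : Set Γ) : Prop :=
  ∃ (L : ℝ) (φ : ℝ → Γ), CircleParam S L φ

end
/-- A bundled metric graph. -/
structure MetricGraph : Type 1 where
  carrier : Type
  [ms : MetricSpace carrier]
  graph : IsMetricGraph carrier

attribute [instance] MetricGraph.ms

/-- A metric graph `G` obtained from a metric graph `G₀` by attaching a loop `γ`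
(a metric circle) at a point `v ∈ G₀`. -/
structure LoopAttachment : Type 1 where
  G : Type
  [ms : MetricSpace G]
  graph : IsMetricGraph G
  G₀ : Set G
  γ : Set G
  v : G
  hv : v ∈ G₀
  closed₀ : IsClosed G₀
  closedγ : IsClosed γ
  cover : G₀ ∪ γ = Set.univ
  meet : G₀ ∩ γ = {v}
  graph₀ : IsMetricGraph ↥G₀
  circleγ : IsCircleSet γ

attribute [instance] LoopAttachment.ms
/-- A chain of `a` loops `γ₁, …, γ_a` with consecutive loops meeting in the points
`w₁, …, w_{a-1}`, together with marked points `vg ∈ γ₁ \ {w₁}` and `vg' ∈ γ_a \ {w_{a-1}}`. -/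
structure ChainOfLoops (a : ℕ) : Type 1 where
  ha : 1 ≤ a
  Γ : Type
  [ms : MetricSpace Γ]
  graph : IsMetricGraph Γ
  loop : ℕ → Set Γ
  w : ℕ → Γ
  vg : Γ
  vg' : Γ
  circle : ∀ i ∈ Finset.Icc 1 a, IsCircleSet (loop i)
  closedLoop : ∀ i ∈ Finset.Icc 1 a, IsClosed (loop i)
  cover : (⋃ i ∈ Finset.Icc 1 a, loop i) = Set.univ
  chainMeet : ∀ i ∈ Finset.Icc 1 (a - 1), loop i ∩ loop (i + 1) = {w i}
  chainDisj : ∀ i ∈ Finset.Icc 1 a, ∀ j ∈ Finset.Icc 1 a, i + 2 ≤ j → loop i ∩ loop j = ∅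
  hvg : vg ∈ loop 1
  hvg' : vg' ∈ loop a
  hvgw : 2 ≤ a → vg ≠ w 1
  hvg'w : 2 ≤ a → vg' ≠ w (a - 1)

attribute [instance] ChainOfLoops.ms

/-- The chain-plus-loops graph: a chain `Γ₀` of `a` loops (with the genericity condition
that the two edges joining `w_i` to `w_{i+1}` have different lengths), marked points
`v_{a+1}, …, v_g` on `Γ₀` (with `v_g ∈ γ₁ \ {w₁}`, `2v_g ≁ 2w₁` on `γ₁`, and
`v_{g-1} ∈ γ_a \ {w_{a-1}}`, `2v_{g-1} ≁ 2w_{a-1}` on `γ_a`), and a loop `γ_i`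
attached at `v_i` for each `a + 1 ≤ i ≤ g`. -/
structure ChainPlusLoops (a g : ℕ) : Type 1 where
  ha : 1 ≤ a
  hg : a + 3 ≤ g
  Γ : Type
  [ms : MetricSpace Γ]
  graph : IsMetricGraph Γ
  loop : ℕ → Set Γ
  w : ℕ → Γ
  v : ℕ → Γ
  Γ₀ : Set Γ
  hΓ₀ : Γ₀ = ⋃ i ∈ Finset.Icc 1 a, loop i
  circle : ∀ i ∈ Finset.Icc 1 g, IsCircleSet (loop i)
  closedLoop : ∀ i ∈ Finset.Icc 1 g, IsClosed (loop i)
  chainMeet : ∀ i ∈ Finset.Icc 1 (a - 1), loop i ∩ loop (i + 1) = {w i}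
  chainDisj : ∀ i ∈ Finset.Icc 1 a, ∀ j ∈ Finset.Icc 1 a, i + 2 ≤ j → loop i ∩ loop j = ∅
  edgeLengths : ∀ i ∈ Finset.Icc 1 (a - 2), ∃ (L : ℝ) (φ : ℝ → Γ) (l : ℝ),
    CircleParam (loop (i + 1)) L φ ∧ φ 0 = w i ∧ 0 < l ∧ l < L ∧ φ l = w (i + 1) ∧ 2 * l ≠ L
  cover : Γ₀ ∪ (⋃ i ∈ Finset.Icc (a + 1) g, loop i) = Set.univ
  hvg : v g ∈ loop 1
  hvg' : v (g - 1) ∈ loop a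
  hvgw : 2 ≤ a → v g ≠ w 1
  hvg'w : 2 ≤ a → v (g - 1) ≠ w (a - 1)
  vgGeneric : 2 ≤ a →
    ¬ LinEquivOn (loop 1) (Finsupp.single (v g) 2) (Finsupp.single (w 1) 2)
  vg'Generic : 2 ≤ a →
    ¬ LinEquivOn (loop a) (Finsupp.single (v (g - 1)) 2) (Finsupp.single (w (a - 1)) 2)
  hvMem : ∀ i ∈ Finset.Icc (a + 1) g, v i ∈ Γ₀
  hvInj : ∀ i ∈ Finset.Icc (a + 1) g, ∀ j ∈ Finset.Icc (a + 1) g, i ≠ j → v i ≠ v j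
  hvw : ∀ i ∈ Finset.Icc (a + 1) g, ∀ k ∈ Finset.Icc 1 (a - 1), v i ≠ w k
  attachMeet : ∀ i ∈ Finset.Icc (a + 1) g, loop i ∩ Γ₀ = {v i}
  attachDisj : ∀ i ∈ Finset.Icc (a + 1) g, ∀ j ∈ Finset.Icc (a + 1) g, i ≠ j →
    loop i ∩ loop j = ∅
  graph₀ : IsMetricGraph ↥Γ₀
  hGenus : graphGenus Γ = (g : ℤ)

attribute [instance] ChainPlusLoops.ms

open Filter Topology

theorem ArcEquiv.symm {Γ : Type*} {τ τ' : ℝ → Γ} (h : ArcEquiv τ τ') : ArcEquiv τ' τ := by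
  obtain ⟨ε, hε, h⟩ := h
  exact ⟨ε, hε, fun t ht => (h t ht).symm⟩

theorem ArcEquiv.trans {Γ : Type*} {τ τ' τ'' : ℝ → Γ} (h : ArcEquiv τ τ')
    (h' : ArcEquiv τ' τ'') : ArcEquiv τ τ'' := by
  obtain ⟨ε, hε, h⟩ := h
  obtain ⟨δ, hδ, h'⟩ := h'
  refine ⟨min ε δ, lt_min hε hδ, fun t ht => ?_⟩
  rw [h t ⟨ht.1, ht.2.trans (min_le_left _ _)⟩, h' t ⟨ht.1, ht.2.trans (min_le_right _ _)⟩]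

theorem HasSlopeAlong.congr {Γ : Type*} {f : Γ → ℝ} {τ τ' : ℝ → Γ} {s : ℤ}
    (h : HasSlopeAlong f τ s) (hτ : ArcEquiv τ τ') : HasSlopeAlong f τ' s := by
  obtain ⟨ε, hε, h⟩ := h
  obtain ⟨δ, hδ, hτ⟩ := hτ
  refine ⟨min ε δ, lt_min hε hδ, fun t ht => ?_⟩
  rw [← hτ t ⟨ht.1, ht.2.trans (min_le_right _ _)⟩, ← hτ 0 ⟨le_rfl, hδ.le⟩]
  exact h t ⟨ht.1, ht.2.trans (min_le_left _ _)⟩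

theorem HasSlopeAlong.unique {Γ : Type*} {f : Γ → ℝ} {τ : ℝ → Γ} {s s' : ℤ}
    (h : HasSlopeAlong f τ s) (h' : HasSlopeAlong f τ s') : s = s' := by
  obtain ⟨ε, hε, h⟩ := h
  obtain ⟨δ, hδ, h'⟩ := h'
  have hm : 0 < min ε δ := lt_min hε hδ
  have h₁ := h (min ε δ) ⟨hm.le, min_le_left _ _⟩
  have h₂ := h' (min ε δ) ⟨hm.le, min_le_right _ _⟩
  have : (s : ℝ) = s' := mul_right_cancel₀ hm.ne' (by linarith)
  exact_mod_cast this

/-- The order of `f` at `P` can be computed from any complete system of tangent directions. -/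
theorem hasOrderAt_iff {Γ : Type*} [MetricSpace Γ] {f : Γ → ℝ} {P : Γ} {m : ℤ}
    {K : Type*} [Fintype K] {α : K → ℝ → Γ} {s : K → ℤ} (harc : ∀ k, IsArcAt P (α k))
    (hne : Pairwise fun i j => ¬ ArcEquiv (α i) (α j))
    (hcomplete : ∀ σ : ℝ → Γ, IsArcAt P σ → ∃ k, ArcEquiv σ (α k))
    (hslope : ∀ k, HasSlopeAlong f (α k) (s k)) :
    HasOrderAt Γ f P m ↔ m = ∑ k, s k := by
  constructor
  · rintro ⟨n, τ, s', hτ, hτne, hτc, hs', rfl⟩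
    choose e he using fun i => hcomplete (τ i) (hτ i)
    have hinj : Function.Injective e := fun i j hij => by
      by_contra hn
      exact hτne hn ((he i).trans (hij ▸ (he j).symm))
    have hsurj : Function.Surjective e := fun k => by
      obtain ⟨i, hi⟩ := hτc (α k) (harc k)
      refine ⟨i, ?_⟩
      by_contra hn
      exact hne hn ((he i).symm.trans hi.symm)
    exact Fintype.sum_bijective e ⟨hinj, hsurj⟩ _ _ fun i =>
      ((hs' i).congr (he i)).unique (hslope _)
  · rintro rfl
    let e := (Fintype.equivFin K).symm
    refine ⟨Fintype.card K, fun i => α (e i), fun i => s (e i), fun i => harc _,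
      fun i j hij => hne (e.injective.ne hij), fun σ hσ => ?_, fun i => hslope _,
      (e.sum_comp s).symm⟩
    obtain ⟨k, hk⟩ := hcomplete σ hσ
    exact ⟨e.symm k, by simpa using hk⟩

/-- `F` is affine on each side of every `t`, with outgoing slopes `p t` to the right and
`m t` to the left. -/
def HasLocalSlopes (F : ℝ → ℝ) (p m : ℝ → ℤ) : Prop :=
  ∀ t, ∃ ε > (0 : ℝ), ∀ s ∈ Set.Icc (0 : ℝ) ε,
    F (t + s) = F t + p t * s ∧ F (t - s) = F t + m t * s

namespace HasLocalSlopes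

variable {F : ℝ → ℝ} {p m : ℝ → ℤ}

theorem p_eq (h : HasLocalSlopes F p m) {t δ : ℝ} {c : ℤ} (hδ : 0 < δ)
    (hc : ∀ s ∈ Set.Icc (0 : ℝ) δ, F (t + s) = F t + c * s) : p t = c := by
  obtain ⟨ε, hε, hF⟩ := h t
  have hm : 0 < min ε δ := lt_min hε hδ
  have h₁ := (hF (min ε δ) ⟨hm.le, min_le_left _ _⟩).1
  have h₂ := hc (min ε δ) ⟨hm.le, min_le_right _ _⟩
  have : (p t : ℝ) = c := mul_right_cancel₀ hm.ne' (by linarith)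
  exact_mod_cast this

theorem m_eq (h : HasLocalSlopes F p m) {t δ : ℝ} {c : ℤ} (hδ : 0 < δ)
    (hc : ∀ s ∈ Set.Icc (0 : ℝ) δ, F (t - s) = F t + c * s) : m t = c := by
  obtain ⟨ε, hε, hF⟩ := h t
  have hm : 0 < min ε δ := lt_min hε hδ
  have h₁ := (hF (min ε δ) ⟨hm.le, min_le_left _ _⟩).2
  have h₂ := hc (min ε δ) ⟨hm.le, min_le_right _ _⟩
  have : (m t : ℝ) = c := mul_right_cancel₀ hm.ne' (by linarith)
  exact_mod_cast this

theorem slopes_near (h : HasLocalSlopes F p m) (t : ℝ) : ∃ ε > (0 : ℝ), ∀ s ∈ Set.Ioo (0 : ℝ) ε,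
    p (t + s) = p t ∧ m (t + s) = -p t ∧ p (t - s) = -m t ∧ m (t - s) = m t := by
  obtain ⟨ε, hε, hF⟩ := h t
  refine ⟨ε, hε, fun s hs => ?_⟩
  have hs₀ := hs.1
  have hs₁ : 0 < ε - s := sub_pos.2 hs.2
  obtain ⟨hp, hm⟩ := hF s ⟨hs₀.le, hs.2.le⟩
  refine ⟨h.p_eq hs₁ fun u hu => ?_, h.m_eq hs₀ fun u hu => ?_, h.p_eq hs₀ fun u hu => ?_,
    h.m_eq hs₁ fun u hu => ?_⟩
  · have := (hF (s + u) ⟨by linarith [hu.1], by linarith [hu.2]⟩).1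
    rw [add_assoc, this, hp]; ring
  · have := (hF (s - u) ⟨by linarith [hu.2], by linarith [hu.1, hs.2]⟩).1
    rw [add_sub_assoc, this, hp]; push_cast; ring
  · have := (hF (s - u) ⟨by linarith [hu.2], by linarith [hu.1, hs.2]⟩).2
    rw [show t - s + u = t - (s - u) by ring, this, hm]; push_cast; ring
  · have := (hF (s + u) ⟨by linarith [hu.1], by linarith [hu.2]⟩).2
    rw [sub_sub, this, hm]; ring

theorem continuous (h : HasLocalSlopes F p m) : Continuous F := by
  refine continuous_iff_continuousAt.2 fun t => ?_
  obtain ⟨ε, hε, hF⟩ := h t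
  have hr : ContinuousWithinAt F (Set.Ici t) t := by
    have hc : ContinuousWithinAt (fun x => F t + p t * (x - t)) (Set.Ici t) t := by fun_prop
    refine hc.congr_of_eventuallyEq ?_ (by simp)
    filter_upwards [Icc_mem_nhdsGE (show t < t + ε by linarith)] with x hx
    have := (hF (x - t) ⟨by linarith [hx.1], by linarith [hx.2]⟩).1
    rwa [add_sub_cancel] at this
  have hl : ContinuousWithinAt F (Set.Iic t) t := by
    have hc : ContinuousWithinAt (fun x => F t + m t * (t - x)) (Set.Iic t) t := by fun_prop
    refine hc.congr_of_eventuallyEq ?_ (by simp)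
    filter_upwards [Icc_mem_nhdsLE (show t - ε < t by linarith)] with x hx
    have := (hF (t - x) ⟨by linarith [hx.2], by linarith [hx.1]⟩).2
    rwa [sub_sub_cancel] at this
  exact continuousAt_iff_continuous_left_right.2 ⟨hl, hr⟩

/-- The right slope at `b` is the right slope at `a` plus the orders at the points of `(a, b]`. -/
theorem p_eq_add_sum (h : HasLocalSlopes F p m) {a b : ℝ} (hab : a ≤ b) (Z : Finset ℝ)
    (hZ : ∀ t ∈ Set.Ioc a b, p t + m t ≠ 0 → t ∈ Z) :
    p b = p a + ∑ t ∈ Z with t ∈ Set.Ioc a b, (p t + m t) := by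
  classical
  set G : ℝ → ℤ := fun x => p x - ∑ t ∈ Z with t ∈ Set.Ioc a x, (p t + m t) with hG
  -- the value of `G` does not change from `x` to `y` if the jump at `y` accounts for it
  have key : ∀ x y, a ≤ x → x < y → y ≤ b → (∀ t ∈ Set.Ioo x y, p t + m t = 0) →
      p y - (p y + m y) = p x → G x = G y := by
    intro x y hax hxy hyb h0 hp
    have hsum : ∑ t ∈ Z with t ∈ Set.Ioc a y, (p t + m t)
        = ∑ t ∈ Z with t ∈ Set.Ioc a x, (p t + m t) + (p y + m y) := by
      have hsub : (Z.filter (· ∈ Set.Ioc a y)) =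
          (Z.filter (· ∈ Set.Ioc a x)) ∪ Z.filter (· ∈ Set.Ioc x y) := by
        ext t
        simp only [Finset.mem_union, Finset.mem_filter, Set.mem_Ioc]
        constructor
        · rintro ⟨ht, h1, h2⟩
          rcases le_or_gt t x with h3 | h3
          · exact Or.inl ⟨ht, h1, h3⟩
          · exact Or.inr ⟨ht, h3, h2⟩
        · rintro (⟨ht, h1, h2⟩ | ⟨ht, h1, h2⟩)
          · exact ⟨ht, h1, h2.trans hxy.le⟩
          · exact ⟨ht, hax.trans_lt h1, h2⟩
      rw [hsub, Finset.sum_union]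
      · congr 1
        refine Finset.sum_eq_single y (fun t ht hty => ?_) fun hy => ?_
        · obtain ⟨-, h1, h2⟩ := Finset.mem_filter.1 ht
          exact h0 t ⟨h1, lt_of_le_of_ne h2 hty⟩
        · by_contra hne
          exact hy (Finset.mem_filter.2 ⟨hZ y ⟨hax.trans_lt hxy, hyb⟩ hne, hxy, le_rfl⟩)
      · refine Finset.disjoint_left.2 fun t h1 h2 => ?_
        exact absurd (Finset.mem_filter.1 h1).2.2 (not_le.2 (Finset.mem_filter.1 h2).2.1)
    simp only [hG, hsum]
    linarith
  have hcont : ContinuousOn G (Set.Icc a b) := by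
    intro x hx
    obtain ⟨ε, hε, hs⟩ := h.slopes_near x
    have hev : G =ᶠ[𝓝[Set.Icc a b] x] fun _ => G x := by
      filter_upwards [self_mem_nhdsWithin,
        mem_nhdsWithin_of_mem_nhds (Ioo_mem_nhds (show x - ε < x by linarith)
          (show x < x + ε by linarith))] with y hy hyx
      have hr : ∀ u ∈ Set.Ioo x (x + ε), p u = p x ∧ m u = -p x := fun u hu => by
        have := hs (u - x) ⟨by linarith [hu.1], by linarith [hu.2]⟩
        rw [add_sub_cancel] at this
        exact ⟨this.1, this.2.1⟩
      have hl : ∀ u ∈ Set.Ioo (x - ε) x, p u = -m x ∧ m u = m x := fun u hu => by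
        have := hs (x - u) ⟨by linarith [hu.2], by linarith [hu.1]⟩
        rw [sub_sub_cancel] at this
        exact this.2.2
      rcases lt_trichotomy x y with hlt | heq | hlt
      · refine (key x y hx.1 hlt hy.2 (fun u hu => ?_) ?_).symm
        · have := hr u ⟨hu.1, hu.2.trans hyx.2⟩
          omega
        · have := hr y ⟨hlt, hyx.2⟩
          omega
      · rw [heq]
      · refine key y x hy.1 hlt hx.2 (fun u hu => ?_) ?_
        · have := hl u ⟨hyx.1.trans hu.1, hu.2⟩
          omega
        · have := hl y ⟨hyx.1, hlt⟩
          omega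
    exact (continuousWithinAt_const (b := G x)).congr_of_eventuallyEq hev rfl
  have hGab := isPreconnected_Icc.constant hcont (Set.left_mem_Icc.2 hab) (Set.right_mem_Icc.2 hab)
  simp only [hG, Set.Ioc_self, Set.mem_empty_iff_false, Finset.filter_false, Finset.sum_empty,
    sub_zero] at hGab
  linarith

/-- A function with constant right slope on `[a, b)` is affine on `[a, b]`. -/
theorem eq_of_const (h : HasLocalSlopes F p m) {a b : ℝ} (hab : a ≤ b) {c : ℤ}
    (hc : ∀ t ∈ Set.Ico a b, p t = c) : F b = F a + c * (b - a) := by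
  have := constant_of_has_deriv_right_zero (f := fun x => F x - c * (x - a)) (a := a) (b := b)
    (by have := h.continuous; fun_prop) (fun x hx => by
      obtain ⟨ε, hε, hF⟩ := h x
      have h₁ : HasDerivWithinAt F (c : ℝ) (Set.Ici x) x := by
        have h₂ : HasDerivWithinAt (fun y => F x + c * (y - x)) (c : ℝ) (Set.Ici x) x := by
          simpa using ((((hasDerivAt_id x).sub_const x).const_mul (c : ℝ)).const_add
            (F x)).hasDerivWithinAt
        refine h₂.congr_of_eventuallyEq ?_ (by simp)
        filter_upwards [Icc_mem_nhdsGE (show x < x + ε by linarith)] with y hy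
        have := (hF (y - x) ⟨by linarith [hy.1], by linarith [hy.2]⟩).1
        rwa [add_sub_cancel, hc x hx] at this
      have h₃ := h₁.sub (((hasDerivAt_id x).sub_const a).const_mul (c : ℝ)).hasDerivWithinAt
        (s := Set.Ici x)
      rw [mul_one, sub_self] at h₃
      exact h₃)
    b (Set.right_mem_Icc.2 hab)
  simp only [sub_self, mul_zero, sub_zero] at this
  linarith

theorem finite_order_ne_zero (h : HasLocalSlopes F p m) (a b : ℝ) :
    {t ∈ Set.Ioc a b | p t + m t ≠ 0}.Finite := by
  have hU : ∀ t, ∃ U ∈ 𝓝 t, ∀ u ∈ U, p u + m u ≠ 0 → u = t := fun t => by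
    obtain ⟨ε, hε, hs⟩ := h.slopes_near t
    refine ⟨Set.Ioo (t - ε) (t + ε), Ioo_mem_nhds (by linarith) (by linarith), fun u hu hne => ?_⟩
    by_contra hut
    rcases lt_or_gt_of_ne hut with hlt | hlt
    · have := hs (t - u) ⟨by linarith, by linarith [hu.1]⟩
      rw [sub_sub_cancel] at this
      omega
    · have := hs (u - t) ⟨by linarith, by linarith [hu.2]⟩
      rw [add_sub_cancel] at this
      omega
  choose U hUn hU using hU
  obtain ⟨T, -, hT⟩ := (isCompact_Icc (a := a) (b := b)).elim_nhds_subcover U fun t _ => hUn t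
  refine T.finite_toSet.subset fun t ht => ?_
  obtain ⟨x, hx, htx⟩ := Set.mem_iUnion₂.1 (hT (Set.Ioc_subset_Icc_self ht.1))
  exact hU x t htx ht.2 ▸ hx

theorem p_periodic (h : HasLocalSlopes F p m) {L : ℝ} (hL : ∀ t, F (t + L) = F t) (t : ℝ) :
    p (t + L) = p t := by
  obtain ⟨ε, hε, hF⟩ := h t
  refine h.p_eq hε fun s hs => ?_
  rw [add_right_comm, hL, hL, (hF s hs).1]

theorem m_periodic (h : HasLocalSlopes F p m) {L : ℝ} (hL : ∀ t, F (t + L) = F t) (t : ℝ) :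
    m (t + L) = m t := by
  obtain ⟨ε, hε, hF⟩ := h t
  refine h.m_eq hε fun s hs => ?_
  rw [add_sub_right_comm, hL, hL, (hF s hs).2]

end HasLocalSlopes

namespace CircleParam

variable {X : Type*} [MetricSpace X] {S : Set X} {L : ℝ} {φ : ℝ → X}

theorem comp_neg (h : CircleParam S L φ) : CircleParam S L fun t => φ (-t) := by
  obtain ⟨hL, hper, hS, hd⟩ := h
  refine ⟨hL, fun t => ?_, ?_, fun s t hst => ?_⟩
  · change φ (-(t + L)) = φ (-t)
    rw [← hper (-(t + L)), neg_add, neg_add_cancel_right]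
  · rw [← hS]
    exact neg_surjective.range_comp φ
  · rw [hd _ _ (by rwa [neg_sub_neg, abs_sub_comm]), neg_sub_neg, abs_sub_comm]

theorem mem (h : CircleParam S L φ) (t : ℝ) : φ t ∈ S := h.2.2.1 ▸ Set.mem_range_self t

theorem periodic (h : CircleParam S L φ) : Function.Periodic φ L := h.2.1

theorem continuous (h : CircleParam S L φ) : Continuous φ := by
  refine Metric.continuous_iff.2 fun t ε hε => ⟨min ε (L / 2), lt_min hε (half_pos h.1), ?_⟩
  intro s hs
  rw [Real.dist_eq] at hs
  rw [h.2.2.2 s t (hs.le.trans (min_le_right _ _))]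
  exact hs.trans_le (min_le_left _ _)

theorem exists_mem_Ioc (h : CircleParam S L φ) (a : ℝ) {x : X} (hx : x ∈ S) :
    ∃ t ∈ Set.Ioc a (a + L), φ t = x := by
  obtain ⟨t, rfl⟩ := h.2.2.1.symm ▸ hx
  exact (h.periodic.exists_mem_Ioc h.1 t a).imp fun _ ht => ⟨ht.1, ht.2.symm⟩

theorem isClosed (h : CircleParam S L φ) : IsClosed S := by
  have hS : S = φ '' Set.Icc 0 L := by
    refine Set.Subset.antisymm (fun x hx => ?_) ?_
    · obtain ⟨t, ht, rfl⟩ := h.exists_mem_Ioc 0 hx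
      rw [zero_add] at ht
      exact ⟨t, Set.Ioc_subset_Icc_self ht, rfl⟩
    · rintro _ ⟨t, -, rfl⟩
      exact h.mem t
  rw [hS]
  exact (isCompact_Icc.image h.continuous).isClosed

theorem eq_of_lt (h : CircleParam S L φ) {s t : ℝ} (hst : φ s = φ t) (hlt : |s - t| < L) :
    s = t := by
  wlog hle : t ≤ s generalizing s t
  · exact (this hst.symm (by rwa [abs_sub_comm]) (not_le.1 hle).le).symm
  rw [abs_of_nonneg (sub_nonneg.2 hle)] at hlt
  rcases le_or_gt (s - t) (L / 2) with h1 | h1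
  · have := h.2.2.2 s t (by rwa [abs_of_nonneg (sub_nonneg.2 hle)])
    rw [hst, dist_self] at this
    exact sub_eq_zero.1 (abs_eq_zero.1 this.symm)
  · have habs : |s - (t + L)| = t + L - s := by
      rw [abs_of_nonpos (by linarith)]; ring
    have := h.2.2.2 s (t + L) (by rw [habs]; linarith)
    rw [h.2.1, hst, dist_self, habs] at this
    linarith

theorem isArcAt (h : CircleParam S L φ) (t : ℝ) : IsArcAt (φ t) fun s => φ (t + s) := by
  refine ⟨by simp, L / 2, half_pos h.1, fun u hu v hv => ?_⟩
  rw [h.2.2.2 _ _ (by rw [add_sub_add_left_eq_sub, abs_le]; constructor <;>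
    linarith [hu.1, hu.2, hv.1, hv.2]), add_sub_add_left_eq_sub]

theorem isArcAt_sub (h : CircleParam S L φ) (t : ℝ) : IsArcAt (φ t) fun s => φ (t - s) := by
  simpa [sub_eq_neg_add, add_comm] using h.comp_neg.isArcAt (-t)

theorem exists_mem_ne (h : CircleParam S L φ) {x : X} (hx : x ∈ S) : ∃ y ∈ S, y ≠ x := by
  obtain ⟨t, -, rfl⟩ := h.exists_mem_Ioc 0 hx
  refine ⟨φ (t + L / 2), h.mem _, fun he => (half_pos h.1).ne' ?_⟩
  have hL := half_lt_self h.1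
  have := h.eq_of_lt he (by rwa [add_sub_cancel_left, abs_of_pos (half_pos h.1)])
  linarith

theorem restrict (h : CircleParam S L φ) {A : Set X} (hA : S ⊆ A) :
    CircleParam (Subtype.val ⁻¹' S : Set A) L fun t => (⟨φ t, hA (h.mem t)⟩ : A) := by
  refine ⟨h.1, fun t => Subtype.ext (h.2.1 t), Set.ext fun x => ?_, h.2.2.2⟩
  simp only [Set.mem_range, Subtype.ext_iff, Set.mem_preimage]
  rw [← h.2.2.1]
  rfl

/-- A rational function has local slopes along a metric circle. -/
theorem exists_hasLocalSlopes (h : CircleParam S L φ) {f : X → ℝ} (hf : IsRational X f) :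
    ∃ p m : ℝ → ℤ, HasLocalSlopes (f ∘ φ) p m := by
  choose p hp using fun t => hf.2 _ _ (h.isArcAt t)
  choose m hm using fun t => hf.2 _ _ (h.isArcAt_sub t)
  refine ⟨p, m, fun t => ?_⟩
  obtain ⟨ε, hε, h₁⟩ := hp t
  obtain ⟨δ, hδ, h₂⟩ := hm t
  refine ⟨min ε δ, lt_min hε hδ, fun s hs => ⟨?_, ?_⟩⟩
  · simpa using h₁ s ⟨hs.1, hs.2.trans (min_le_left _ _)⟩
  · simpa using h₂ s ⟨hs.1, hs.2.trans (min_le_right _ _)⟩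

/-- The divisor of a function with local slopes on a metric circle: it has degree zero, and
it is not a difference of two distinct points. -/
theorem exists_divisor (h : CircleParam S L φ) {f : X → ℝ} {p m : ℝ → ℤ}
    (hf : HasLocalSlopes (f ∘ φ) p m) :
    ∃ o : Divisor X, (∀ t, o (φ t) = p t + m t) ∧ (∀ x ∉ S, o x = 0) ∧ divDeg o = 0 ∧
      ∀ x y, x ≠ y → o ≠ Finsupp.single x 1 - Finsupp.single y 1 := by
  classical
  have hper : ∀ t, (f ∘ φ) (t + L) = (f ∘ φ) t := fun t => congrArg f (h.2.1 t)
  have hfin := hf.finite_order_ne_zero 0 L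
  set Z := hfin.toFinset with hZ
  have hZmem : ∀ t, t ∈ Z ↔ t ∈ Set.Ioc 0 L ∧ p t + m t ≠ 0 := fun t => by simp [hZ]
  set o : Divisor X := ∑ t ∈ Z, Finsupp.single (φ t) (p t + m t) with ho
  have hval₀ : ∀ t ∈ Set.Ioc 0 L, o (φ t) = p t + m t := by
    intro t ht
    rw [ho, Finsupp.finsetSum_apply, Finset.sum_eq_single t]
    · simp
    · intro u hu hut
      refine Finsupp.single_eq_of_ne fun hφ => hut ?_
      have hu' := ((hZmem u).1 hu).1
      exact h.eq_of_lt hφ.symm (abs_lt.2 ⟨by linarith [ht.2, hu'.1], by linarith [ht.1, hu'.2]⟩)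
    · intro htZ
      have : p t + m t = 0 := by
        by_contra hne
        exact htZ ((hZmem t).2 ⟨ht, hne⟩)
      simp [this]
  have hq : Function.Periodic (fun t => p t + m t) L := fun t => by
    simp only [hf.p_periodic hper, hf.m_periodic hper]
  have hval : ∀ t, o (φ t) = p t + m t := by
    intro t
    have hpair : Function.Periodic (fun t => o (φ t) - (p t + m t)) L := fun t => by
      have := hq t
      simp only at this
      simp only [h.periodic t, this]
    obtain ⟨u, hu, hut⟩ := hpair.exists_mem_Ioc h.1 t 0
    rw [zero_add] at hu
    rw [← sub_eq_zero, hut, sub_eq_zero]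
    exact hval₀ u hu
  have hoS : ∀ x ∉ S, o x = 0 := fun x hx => by
    rw [ho, Finsupp.finsetSum_apply]
    refine Finset.sum_eq_zero fun t _ => Finsupp.single_eq_of_ne ?_
    rintro rfl
    exact hx (h.mem t)
  refine ⟨o, hval, hoS, ?_, ?_⟩
  · have hdeg : divDeg o = ∑ t ∈ Z, (p t + m t) := by
      change Finsupp.sum o _ = _
      rw [ho, ← Finsupp.sum_finsetSum_index (fun _ => rfl) (fun _ _ _ => rfl)]
      exact Finset.sum_congr rfl fun t _ => Finsupp.sum_single_index rfl
    have hsum := hf.p_eq_add_sum h.1.le Z fun t ht hne => (hZmem t).2 ⟨ht, hne⟩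
    have hp := hf.p_periodic hper 0
    rw [zero_add] at hp
    rw [Finset.filter_true_of_mem fun t ht => ((hZmem t).1 ht).1, hp] at hsum
    rw [hdeg]
    linarith
  · intro x y hxy hoxy
    have hox : o x = 1 := by simp [hoxy, hxy]
    have hoy : o y = -1 := by simp [hoxy, hxy.symm]
    have ho0 : ∀ z, z ≠ x → z ≠ y → o z = 0 := fun z hzx hzy => by simp [hoxy, hzx, hzy]
    have hS : ∀ z, o z ≠ 0 → z ∈ S := fun z hz => by
      by_contra hzS
      exact hz (hoS z hzS)
    obtain ⟨b, -, rfl⟩ := h.exists_mem_Ioc 0 (hS y (by omega))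
    obtain ⟨q, hq, rfl⟩ := h.exists_mem_Ioc b (hS x (by omega))
    have hqL : q < b + L := lt_of_le_of_ne hq.2 fun he => hxy (by rw [he, h.2.1])
    have hord : ∀ t ∈ Set.Ioo b (b + L), t ≠ q → p t + m t = 0 := fun t ht htq => by
      rw [← hval]
      refine ho0 _ (fun he => htq (h.eq_of_lt he ?_)) fun he => ht.1.ne' (h.eq_of_lt he ?_)
      · exact abs_lt.2 ⟨by linarith [ht.1], by linarith [hq.1, ht.2]⟩
      · exact abs_lt.2 ⟨by linarith [ht.1, h.1], by linarith [ht.2]⟩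
    have hpt : ∀ t ∈ Set.Ico b (b + L), p t = p b + if q ≤ t then 1 else 0 := fun t ht => by
      have := hf.p_eq_add_sum ht.1 {q} fun u hu hne => by
        by_contra huq
        exact hne (hord u ⟨hu.1, hu.2.trans_lt ht.2⟩ (by simpa using huq))
      rw [this, Finset.sum_filter, Finset.sum_singleton, ← hval, hox]
      simp [hq.1]
    have h₁ := hf.eq_of_const hq.1.le (c := p b) fun t ht => by
      rw [hpt t ⟨ht.1, ht.2.trans hqL⟩, if_neg (not_le.2 ht.2), add_zero]
    have h₂ := hf.eq_of_const hqL.le (c := p b + 1) fun t ht => by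
      rw [hpt t ⟨hq.1.le.trans ht.1, ht.2⟩, if_pos ht.1]
    rw [hper, h₁] at h₂
    push_cast at h₂
    have hb := hq.1
    rcases le_or_gt 0 (p b) with hc | hc
    · have : (0 : ℝ) ≤ p b := by exact_mod_cast hc
      nlinarith
    · have : (p b : ℝ) ≤ -1 := by exact_mod_cast Int.le_sub_one_of_lt hc
      nlinarith

end CircleParam

/-- The metric circles `S i`, parametrized by `φ i`, cover `X`, and any two of them meet in at
most one point. -/
structure IsCircleCover {X ι : Type*} [MetricSpace X] (S : ι → Set X) (L : ι → ℝ)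
    (φ : ι → ℝ → X) : Prop where
  param : ∀ i, CircleParam (S i) (L i) (φ i)
  cover : ∀ x, ∃ i, x ∈ S i
  inter : ∀ i j, i ≠ j → (S i ∩ S j).Subsingleton

namespace IsCircleCover

variable {X ι : Type*} [MetricSpace X] {S : ι → Set X} {L : ι → ℝ} {φ : ι → ℝ → X}

theorem dist_arc (h : IsCircleCover S L φ) (i : ι) (σ : ℤˣ) (t : ℝ) {s : ℝ} (hs : 0 ≤ s)
    (hsL : s ≤ L i / 2) : dist (φ i (t + (σ : ℤ) * s)) (φ i t) = s := by
  have habs : |t + ((σ : ℤ) : ℝ) * s - t| = s := by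
    rw [add_sub_cancel_left]
    rcases Int.units_eq_one_or σ with rfl | rfl <;> simp [abs_of_nonneg hs]
  rw [(h.param i).2.2.2 _ _ (by rwa [habs]), habs]

theorem eventually_le_length [Finite ι] (h : IsCircleCover S L φ) :
    ∀ᶠ s in 𝓝[>] (0 : ℝ), ∀ i, s < L i / 4 := by
  refine eventually_all.2 fun i => ?_
  have := (h.param i).1
  filter_upwards [Ioo_mem_nhdsGT (show 0 < L i / 4 by linarith)] with s hs using hs.2

/-- Two distinct arcs running along the circles through `P` do not meet near `P`. -/
theorem arc_injective (h : IsCircleCover S L φ) {P : X} {i j : ι} {t u : ℝ} {σ σ' : ℤˣ}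
    (hi : φ i t = P) (hj : φ j u = P) (htu : i = j → t = u) {s : ℝ} (hs : 0 < s)
    (hsi : s < L i / 4) (hsj : s < L j / 4)
    (heq : φ i (t + (σ : ℤ) * s) = φ j (u + (σ' : ℤ) * s)) : i = j ∧ σ = σ' := by
  have hij : i = j := by
    by_contra hne
    have := h.inter i j hne ⟨(h.param i).mem _, heq ▸ (h.param j).mem _⟩
      ⟨hi ▸ (h.param i).mem _, hj ▸ (h.param j).mem _⟩
    have hd := h.dist_arc i σ t hs.le (by linarith)
    rw [this, hi, dist_self] at hd
    exact hs.ne hd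
  subst hij
  obtain rfl := htu rfl
  refine ⟨rfl, ?_⟩
  by_contra hne
  have habs : |t + ((σ : ℤ) : ℝ) * s - (t + ((σ' : ℤ) : ℝ) * s)| = 2 * s := by
    rcases Int.units_eq_one_or σ with rfl | rfl <;>
      rcases Int.units_eq_one_or σ' with rfl | rfl
    · exact absurd rfl hne
    · norm_num
      rw [← two_mul, abs_of_nonneg (by positivity)]
    · norm_num
      rw [← neg_add', abs_neg, ← two_mul, abs_of_nonneg (by positivity)]
    · exact absurd rfl hne
  have := (h.param i).2.2.2 _ _ (show |t + ((σ : ℤ) : ℝ) * s - (t + ((σ' : ℤ) : ℝ) * s)| ≤ L i / 2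
    by rw [habs]; linarith)
  rw [heq, dist_self, habs] at this
  linarith

/-- Every arc runs, near its base point, along one of the circles. -/
theorem exists_arcEquiv [Finite ι] (h : IsCircleCover S L φ) {P : X} {t : ι → ℝ}
    (ht : ∀ i, P ∈ S i → φ i (t i) = P) {τ : ℝ → X} (hτ : IsArcAt P τ) :
    ∃ k : {i // P ∈ S i} × ℤˣ, ArcEquiv τ fun s => φ k.1 (t k.1 + ((k.2 : ℤ) : ℝ) * s) := by
  obtain ⟨hτ₀, a, ha, hτ⟩ := hτ
  have hdist : ∀ s ∈ Set.Icc 0 a, dist (τ s) P = s := fun s hs => by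
    rw [← hτ₀, hτ s hs 0 ⟨le_rfl, ha.le⟩, sub_zero, abs_of_nonneg hs.1]
  have hcl : IsClosed (⋃ i : {i // P ∉ S i}, S i) :=
    isClosed_iUnion_of_finite fun i => (h.param i).isClosed
  obtain ⟨δ, hδ, hball⟩ := Metric.isOpen_iff.1 hcl.isOpen_compl P
    (by simp only [Set.mem_compl_iff, Set.mem_iUnion, not_exists]; exact fun i => i.2)
  obtain ⟨ε, hεL, hε₀, hεm⟩ := (h.eventually_le_length.and
    (Ioo_mem_nhdsGT (lt_min ha hδ))).exists
  have hεa : ε ≤ a := (hεm.trans_le (min_le_left _ _)).le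
  set α : {i // P ∈ S i} × ℤˣ → ℝ → X := fun k s => φ k.1 (t k.1 + ((k.2 : ℤ) : ℝ) * s) with hα
  have hcov : ∀ s ∈ Set.Icc 0 ε, ∃ k, τ s = α k s := by
    intro s hs
    have hds := hdist s ⟨hs.1, hs.2.trans hεa⟩
    obtain ⟨i, hi⟩ := h.cover (τ s)
    have hPi : P ∈ S i := by
      by_contra hP
      refine hball (Metric.mem_ball.2 (hds.trans_lt (hs.2.trans_lt
        (hεm.trans_le (min_le_right _ _))))) (Set.mem_iUnion.2 ⟨⟨i, hP⟩, hi⟩)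
    obtain ⟨u, hu, hus⟩ := (h.param i).exists_mem_Ioc (t i - L i / 2) hi
    have habs : |u - t i| ≤ L i / 2 := abs_le.2 ⟨by linarith [hu.1], by linarith [hu.2]⟩
    have hd := (h.param i).2.2.2 u (t i) habs
    rw [ht i hPi, hus, hds] at hd
    rcases abs_choice (u - t i) with hc | hc
    · refine ⟨⟨⟨i, hPi⟩, 1⟩, ?_⟩
      rw [← hus, hα]
      simp only [Units.val_one, Int.cast_one, one_mul]
      rw [hd, hc, add_sub_cancel]
    · refine ⟨⟨⟨i, hPi⟩, -1⟩, ?_⟩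
      rw [← hus, hα]
      simp only [Units.val_neg, Units.val_one, Int.cast_neg, Int.cast_one, neg_mul, one_mul]
      rw [hd, hc, neg_neg, add_sub_cancel]
  have hdisj : ∀ s ∈ Set.Ioc 0 ε, ∀ k l, τ s = α k s → τ s = α l s → k = l := by
    rintro s hs ⟨⟨i, hi⟩, σ⟩ ⟨⟨j, hj⟩, σ'⟩ h1 h2
    obtain ⟨rfl, rfl⟩ := h.arc_injective (ht i hi) (ht j hj) (fun he => by rw [he]) hs.1
      (hs.2.trans_lt (hεL i)) (hs.2.trans_lt (hεL j)) (h1.symm.trans h2)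
    rfl
  have hτc : ContinuousOn τ (Set.Icc 0 ε) := by
    refine Metric.continuousOn_iff.2 fun s hs η hη => ⟨η, hη, fun u hu hus => ?_⟩
    rwa [hτ u ⟨hu.1, hu.2.trans hεa⟩ s ⟨hs.1, hs.2.trans hεa⟩, ← Real.dist_eq]
  have hclosed : ∀ k, IsClosed {s ∈ Set.Icc 0 ε | τ s = α k s} := fun k => by
    have hαc : Continuous (α k) := (h.param k.1).continuous.comp (by fun_prop)
    have := (hτc.prodMk hαc.continuousOn).preimage_isClosed_of_isClosed isClosed_Icc
      (isClosed_diagonal (X := X))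
    exact this
  obtain ⟨k, hk⟩ := hcov ε ⟨hε₀.le, le_rfl⟩
  refine ⟨k, ε, hε₀, fun s hs => ?_⟩
  rcases hs.1.eq_or_lt with rfl | hs₀
  · rw [hτ₀]
    simp [ht k.1 k.1.2]
  obtain ⟨l, hl⟩ := hcov s hs
  suffices hlk : l = k by rw [hl, hlk]
  by_contra hlk
  have hpre := isPreconnected_closed_iff.1 (isPreconnected_Ioc (a := (0 : ℝ)) (b := ε))
    {s ∈ Set.Icc 0 ε | τ s = α k s} (⋃ l : {l // l ≠ k}, {s ∈ Set.Icc 0 ε | τ s = α l s})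
    (hclosed k) (isClosed_iUnion_of_finite fun l => hclosed l)
    (fun u hu => by
      have huI := Set.Ioc_subset_Icc_self hu
      obtain ⟨l, hl⟩ := hcov u huI
      by_cases hlk : l = k
      · exact Or.inl ⟨huI, hlk ▸ hl⟩
      · exact Or.inr (Set.mem_iUnion.2 ⟨⟨l, hlk⟩, huI, hl⟩))
    ⟨ε, ⟨hε₀, le_rfl⟩, ⟨hε₀.le, le_rfl⟩, hk⟩
    ⟨s, ⟨hs₀, hs.2⟩, Set.mem_iUnion.2 ⟨⟨l, hlk⟩, hs, hl⟩⟩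
  obtain ⟨u, hu, ⟨-, huk⟩, hul⟩ := hpre
  obtain ⟨⟨l', hl'⟩, -, hul'⟩ := Set.mem_iUnion.1 hul
  exact hl' (hdisj u hu _ _ hul' huk)

/-- The order of `f` at `P` is the sum of the orders of `f` at `P` along the circles. -/
theorem hasOrderAt_iff [Fintype ι] (h : IsCircleCover S L φ) {f : X → ℝ} {p m : ι → ℝ → ℤ}
    (hf : ∀ i, HasLocalSlopes (f ∘ φ i) (p i) (m i)) {o : ι → X → ℤ}
    (ho : ∀ i t, o i (φ i t) = p i t + m i t) (ho₀ : ∀ i, ∀ x ∉ S i, o i x = 0) (P : X) (n : ℤ) :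
    HasOrderAt X f P n ↔ n = ∑ i, o i P := by
  classical
  have hex : ∀ i, ∃ t, P ∈ S i → φ i t = P := fun i => by
    by_cases hP : P ∈ S i
    · obtain ⟨t, -, ht⟩ := (h.param i).exists_mem_Ioc 0 hP
      exact ⟨t, fun _ => ht⟩
    · exact ⟨0, fun hP' => absurd hP' hP⟩
  choose t ht using hex
  have hmain := _root_.hasOrderAt_iff (f := f) (P := P) (m := n)
    (K := {i // P ∈ S i} × ℤˣ)
    (α := fun k s => φ k.1 (t k.1 + ((k.2 : ℤ) : ℝ) * s))
    (s := fun k => if k.2 = 1 then p k.1 (t k.1) else m k.1 (t k.1))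
    (fun ⟨⟨i, hi⟩, σ⟩ => by
      rcases Int.units_eq_one_or σ with rfl | rfl
      · simpa [ht i hi] using (h.param i).isArcAt (t i)
      · simpa [ht i hi, sub_eq_add_neg] using (h.param i).isArcAt_sub (t i))
    (fun ⟨⟨i, hi⟩, σ⟩ ⟨⟨j, hj⟩, σ'⟩ hne ⟨ε, hε, he⟩ => by
      obtain ⟨s, hsL, hs⟩ := (h.eventually_le_length.and (Ioo_mem_nhdsGT hε)).exists
      obtain ⟨rfl, rfl⟩ := h.arc_injective (ht i hi) (ht j hj) (fun he => by rw [he]) hs.1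
        (hsL i) (hsL j) (he s ⟨hs.1.le, hs.2.le⟩)
      exact hne rfl)
    (fun τ hτ => h.exists_arcEquiv ht hτ)
    (fun ⟨⟨i, hi⟩, σ⟩ => by
      obtain ⟨ε, hε, hs⟩ := hf i (t i)
      refine ⟨ε, hε, fun s hs' => ?_⟩
      rcases Int.units_eq_one_or σ with rfl | rfl
      · simpa using (hs s hs').1
      · simpa [sub_eq_add_neg] using (hs s hs').2)
  rw [hmain]
  have hsum : ∑ k : {i // P ∈ S i} × ℤˣ, (if k.2 = 1 then p k.1 (t k.1) else m k.1 (t k.1))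
      = ∑ i, o i P := by
    rw [Fintype.sum_prod_type, ← Finset.sum_subset (Finset.filter_subset (P ∈ S ·) Finset.univ)
      fun i _ hi => ho₀ i P (by simpa using hi),
      Finset.sum_subtype (p := (P ∈ S ·)) _ (by simp)]
    refine Finset.sum_congr rfl fun i _ => ?_
    rw [show (Finset.univ : Finset ℤˣ) = {1, -1} from rfl,
      Finset.sum_pair (by decide), if_pos rfl, if_neg (by simp [show (-1 : ℤˣ) ≠ 1 by decide]), ← ho, ht i i.2]
  rw [hsum]

end IsCircleCover

theorem divDeg_eq_degree {X : Type*} (D : Divisor X) : divDeg D = Finsupp.degree D := rfl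

theorem IsRational.restrict {X : Type*} [MetricSpace X] {f : X → ℝ} (hf : IsRational X f)
    (A : Set X) : IsRational A fun x => f x := by
  refine ⟨hf.1.comp continuous_subtype_val, fun P τ hτ => ?_⟩
  obtain ⟨h₀, a, ha, hd⟩ := hτ
  exact hf.2 P (fun t => τ t) ⟨congrArg Subtype.val h₀, a, ha, hd⟩

theorem LinEquiv.of_sub_eq {X : Type*} [MetricSpace X] {D₁ D₂ D₁' D₂' : Divisor X}
    (h : LinEquiv X D₁ D₂) (heq : D₂ - D₁ = D₂' - D₁') : LinEquiv X D₁' D₂' := by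
  obtain ⟨f, hf, hord⟩ := h
  refine ⟨f, hf, fun P => ?_⟩
  rw [← Finsupp.sub_apply, ← heq]
  exact hord P

theorem RankGE.mono {X : Type*} [MetricSpace X] [Nonempty X] {D : Divisor X} {r n : ℕ}
    (h : RankGE X D n) (hrn : r ≤ n) : RankGE X D r := by
  intro E hE hdeg
  obtain ⟨x⟩ := ‹Nonempty X›
  have hx : Effective (Finsupp.single x ((n - r : ℕ) : ℤ)) := fun P => by
    classical
    rw [Finsupp.single_apply]
    split_ifs <;> simp
  obtain ⟨F, hF, hlin⟩ := h (E + Finsupp.single x ((n - r : ℕ) : ℤ))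
    (fun P => add_nonneg (hE P) (hx P)) (by
      rw [divDeg_eq_degree] at hdeg ⊢
      rw [map_add, hdeg, Finsupp.degree_single]
      omega)
  refine ⟨F + Finsupp.single x ((n - r : ℕ) : ℤ), fun P => add_nonneg (hF P) (hx P),
    hlin.of_sub_eq ?_⟩
  abel

theorem rankGE_of_le_divRank {X : Type*} [MetricSpace X] [Nonempty X] {D : Divisor X} {r : ℕ}
    (hr : 1 ≤ r) (h : (r : ℤ) ≤ divRank X D) : RankGE X D r := by
  set R : Set ℤ := insert (-1) {n : ℤ | ∃ r : ℕ, n = (r : ℤ) ∧ RankGE X D r} with hR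
  have hbdd : BddAbove R := by
    by_contra hb
    have h₀ : divRank X D = 0 := by
      rw [divRank, ← hR, csSup_of_not_bddAbove hb, Int.csSup_empty]
    omega
  have hmem : divRank X D ∈ R := Int.csSup_mem (Set.insert_nonempty _ _) hbdd
  rcases hmem with h₁ | ⟨n, hn, hrank⟩
  · omega
  · exact hrank.mono (by omega)

/-- On a metric circle, a principal divisor with nonnegative coefficients away from `v` has
nonpositive coefficient at `v`, and coefficient at most `-2` if it is positive somewhere else. -/
theorem principal_coeff_le {X : Type*} {o : Divisor X} (hdeg : divDeg o = 0)
    (hne : ∀ x y, x ≠ y → o ≠ Finsupp.single x 1 - Finsupp.single y 1) {v : X}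
    (hv : ∀ x, x ≠ v → 0 ≤ o x) :
    o v ≤ 0 ∧ ∀ q, q ≠ v → 1 ≤ o q → o v ≤ -2 := by
  classical
  have hsplit : o = o.erase v + Finsupp.single v (o v) := (Finsupp.erase_add_single v o).symm
  have hsum : Finsupp.degree (o.erase v) = -o v := by
    have := congrArg Finsupp.degree hsplit
    rw [map_add, Finsupp.degree_single, ← divDeg_eq_degree, hdeg] at this
    linarith
  have hnn : ∀ x, 0 ≤ o.erase v x := fun x => by
    rw [Finsupp.erase_apply]
    split_ifs with hx
    · exact le_rfl
    · exact hv x hx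
  have hnn' : ∀ D : Divisor X, (∀ x, 0 ≤ D x) → 0 ≤ Finsupp.degree D ∧
      (Finsupp.degree D = 0 → D = 0) := fun D hD => by
    rw [Finsupp.degree_apply]
    refine ⟨Finset.sum_nonneg fun x _ => hD x, fun h₀ => Finsupp.ext fun x => ?_⟩
    by_cases hx : x ∈ D.support
    · exact (Finset.sum_eq_zero_iff_of_nonneg fun x _ => hD x).1 h₀ x hx
    · simpa using hx
  refine ⟨by linarith [(hnn' _ hnn).1], fun q hqv hq => ?_⟩
  have hrest : ∀ x, 0 ≤ (o.erase v - Finsupp.single q 1 : Divisor X) x := fun x => by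
    rw [Finsupp.sub_apply, Finsupp.single_apply]
    split_ifs with hx
    · subst hx
      rw [Finsupp.erase_ne hqv]
      omega
    · simpa using hnn x
  obtain ⟨h₁, h₂⟩ := hnn' _ hrest
  rw [map_sub, hsum, Finsupp.degree_single] at h₁ h₂
  by_contra hlt
  have hov : o v = -1 := by omega
  refine hne q v hqv ?_
  rw [hsplit, hov, sub_eq_zero.1 (h₂ (by omega)), Finsupp.single_neg, sub_eq_add_neg]

namespace ChainPlusLoops

variable {a g : ℕ} (C : ChainPlusLoops a g)

theorem loop_subset {i : ℕ} (hi : i ∈ Finset.Icc 1 a) : C.loop i ⊆ C.Γ₀ := by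
  rw [C.hΓ₀]
  exact Set.subset_biUnion_of_mem (u := C.loop) hi

theorem v_mem_loop {j : ℕ} (hj : j ∈ Finset.Icc (a + 1) g) : C.v j ∈ C.loop j :=
  ((C.attachMeet j hj).symm ▸ Set.mem_singleton (C.v j) : C.v j ∈ C.loop j ∩ C.Γ₀).1

theorem eq_v {j : ℕ} (hj : j ∈ Finset.Icc (a + 1) g) {x : C.Γ} (hx : x ∈ C.loop j)
    (hx₀ : x ∈ C.Γ₀) : x = C.v j :=
  (C.attachMeet j hj).subset ⟨hx, hx₀⟩

theorem eq_of_mem_attached {i j : ℕ} (hi : i ∈ Finset.Icc (a + 1) g)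
    (hj : j ∈ Finset.Icc (a + 1) g) {x : C.Γ} (hxi : x ∈ C.loop i) (hxj : x ∈ C.loop j) :
    i = j := by
  by_contra hne
  exact (C.attachDisj i hi j hj hne).subset ⟨hxi, hxj⟩

theorem inter_loop_subsingleton {i j : ℕ} (hi : i ∈ Finset.Icc 1 g) (hj : j ∈ Finset.Icc 1 g)
    (hne : i ≠ j) : (C.loop i ∩ C.loop j).Subsingleton := by
  wlog hlt : i < j generalizing i j
  · rw [Set.inter_comm]
    exact this hj hi hne.symm (by omega)
  rw [Finset.mem_Icc] at hi hj
  rcases le_or_gt j a with hja | hja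
  · rcases (Nat.succ_le_of_lt hlt).eq_or_lt with rfl | hlt'
    · rw [C.chainMeet i (Finset.mem_Icc.2 ⟨hi.1, Nat.le_sub_one_of_lt hja⟩)]
      exact Set.subsingleton_singleton
    · rw [C.chainDisj i (Finset.mem_Icc.2 ⟨hi.1, by omega⟩) j (Finset.mem_Icc.2 ⟨hj.1, hja⟩) hlt']
      exact Set.subsingleton_empty
  · have hj' : j ∈ Finset.Icc (a + 1) g := Finset.mem_Icc.2 ⟨hja, hj.2⟩
    rcases le_or_gt i a with hia | hia
    · have hsub := C.loop_subset (Finset.mem_Icc.2 ⟨hi.1, hia⟩)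
      exact fun x hx y hy => (C.eq_v hj' hx.2 (hsub hx.1)).trans (C.eq_v hj' hy.2 (hsub hy.1)).symm
    · rw [C.attachDisj i (Finset.mem_Icc.2 ⟨hia, hi.2⟩) j hj' hne]
      exact Set.subsingleton_empty

theorem exists_mem_loop (x : C.Γ) : ∃ i ∈ Finset.Icc 1 g, x ∈ C.loop i := by
  have hg := C.hg
  rcases C.cover.symm.subset (Set.mem_univ x) with hx | hx
  · rw [C.hΓ₀] at hx
    obtain ⟨i, hi, hxi⟩ := Set.mem_iUnion₂.1 hx
    exact ⟨i, Finset.Icc_subset_Icc_right (by omega) hi, hxi⟩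
  · obtain ⟨i, hi, hxi⟩ := Set.mem_iUnion₂.1 hx
    exact ⟨i, Finset.Icc_subset_Icc_left (by omega) hi, hxi⟩

variable {L : ℕ → ℝ} {φ : ℕ → ℝ → C.Γ}

theorem isCircleCover (hφ : ∀ i ∈ Finset.Icc 1 g, CircleParam (C.loop i) (L i) (φ i)) :
    IsCircleCover (fun i : Finset.Icc 1 g => C.loop i) (fun i => L i) (fun i => φ i) where
  param i := hφ i i.2
  cover x := by
    obtain ⟨i, hi, hx⟩ := C.exists_mem_loop x
    exact ⟨⟨i, hi⟩, hx⟩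
  inter i j hij := C.inter_loop_subsingleton i.2 j.2 (Subtype.coe_injective.ne hij)

theorem isCircleCover_restrict
    (hφ : ∀ i ∈ Finset.Icc 1 g, CircleParam (C.loop i) (L i) (φ i))
    (hag : Finset.Icc 1 a ⊆ Finset.Icc 1 g) :
    IsCircleCover (fun i : Finset.Icc 1 a => (Subtype.val ⁻¹' C.loop i : Set C.Γ₀))
      (fun i => L i)
      (fun i t => ⟨φ i t, C.loop_subset i.2 ((hφ i (hag i.2)).mem t)⟩) where
  param i := (hφ i (hag i.2)).restrict (C.loop_subset i.2)
  cover x := by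
    obtain ⟨i, hi, hx⟩ := Set.mem_iUnion₂.1 (C.hΓ₀.subset x.2)
    exact ⟨⟨i, hi⟩, hx⟩
  inter i j hij := (C.inter_loop_subsingleton (hag i.2) (hag j.2)
    (Subtype.coe_injective.ne hij)).preimage Subtype.coe_injective

/-- If `D` has rank at least `r` on `Γ` and is supported on `Γ₀`, then on `Γ₀` it is equivalent
to an effective divisor containing twice any `r` of the attaching points. -/
theorem exists_linEquivOn_two_mul {D : Divisor C.Γ} (hD : ↑D.support ⊆ C.Γ₀) {r : ℕ}
    (hrank : RankGE C.Γ D r) {J : Finset ℕ} (hJ : J ⊆ Finset.Icc (a + 1) g) (hcard : J.card = r) :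
    ∃ E : Divisor C.Γ, Effective E ∧ ↑E.support ⊆ C.Γ₀ ∧ divDeg E = divDeg D - 2 * r ∧
      LinEquivOn C.Γ₀ D ((∑ j ∈ J, Finsupp.single (C.v j) 2) + E) := by
  classical
  have hg := C.hg
  have hag : Finset.Icc 1 a ⊆ Finset.Icc 1 g := Finset.Icc_subset_Icc_right (by omega)
  have hatt : Finset.Icc (a + 1) g ⊆ Finset.Icc 1 g := Finset.Icc_subset_Icc_left (by omega)
  have hunion : Finset.Icc 1 g = Finset.Icc 1 a ∪ Finset.Icc (a + 1) g := by
    ext i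
    simp only [Finset.mem_union, Finset.mem_Icc]
    omega
  have hdisj : Disjoint (Finset.Icc 1 a) (Finset.Icc (a + 1) g) :=
    Finset.disjoint_left.2 fun i h₁ h₂ => by
      rw [Finset.mem_Icc] at h₁ h₂
      omega
  have hD₀ : ∀ x ∉ C.Γ₀, D x = 0 := fun x hx =>
    Finsupp.notMem_support_iff.1 fun hx' => hx (hD hx')
  have : Nonempty C.Γ := ⟨C.v g⟩
  choose! L φ hφ using C.circle
  have hq : ∀ j ∈ J, ∃ q ∈ C.loop j, q ≠ C.v j := fun j hj =>
    (hφ j (hatt (hJ hj))).exists_mem_ne (C.v_mem_loop (hJ hj))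
  choose! q hql hqv using hq
  have hB : ∀ x, 0 ≤ (∑ j ∈ J, Finsupp.single (q j) (1 : ℤ)) x := fun x => by
    rw [Finsupp.finsetSum_apply]
    refine Finset.sum_nonneg fun j _ => ?_
    simp only [Finsupp.single_apply]
    split_ifs <;> simp
  have hBq : ∀ j ∈ J, 1 ≤ (∑ j ∈ J, Finsupp.single (q j) (1 : ℤ)) (q j) := fun j hj => by
    rw [Finsupp.finsetSum_apply]
    refine le_trans ?_ (Finset.single_le_sum
      (f := fun i => (Finsupp.single (q i) (1 : ℤ)) (q j)) (fun i _ => ?_) hj)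
    · simp
    · simp only [Finsupp.single_apply]
      split_ifs <;> simp
  obtain ⟨F, hF, f, hf, hord⟩ := hrank (∑ j ∈ J, Finsupp.single (q j) 1) hB (by
    rw [divDeg_eq_degree, map_sum]
    simp [hcard])
  set B : Divisor C.Γ := ∑ j ∈ J, Finsupp.single (q j) 1
  have hslopes : ∀ i ∈ Finset.Icc 1 g, ∃ (p m : ℝ → ℤ) (o : Divisor C.Γ),
      HasLocalSlopes (f ∘ φ i) p m ∧ (∀ t, o (φ i t) = p t + m t) ∧
      (∀ x ∉ C.loop i, o x = 0) ∧ divDeg o = 0 ∧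
      ∀ x y, x ≠ y → o ≠ Finsupp.single x 1 - Finsupp.single y 1 := fun i hi => by
    obtain ⟨p, m, hpm⟩ := (hφ i hi).exists_hasLocalSlopes hf
    obtain ⟨o, ho⟩ := (hφ i hi).exists_divisor hpm
    exact ⟨p, m, o, hpm, ho⟩
  choose! p m o hpm hoφ ho₀ hodeg hone using hslopes
  have hsum : ∀ x, F x + B x = D x + ∑ i ∈ Finset.Icc 1 a, o i x
      + ∑ i ∈ Finset.Icc (a + 1) g, o i x := fun x => by
    have := ((C.isCircleCover hφ).hasOrderAt_iff (fun i => hpm i i.2)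
      (o := fun i => o i) (fun i => hoφ i i.2) (fun i => ho₀ i i.2) x _).1 (hord x)
    rw [Finset.sum_coe_sort (Finset.Icc 1 g) fun i => o i x, hunion, Finset.sum_union hdisj,
      Finsupp.sub_apply] at this
    linarith
  have hchain : ∀ x ∉ C.Γ₀, ∑ i ∈ Finset.Icc 1 a, o i x = 0 := fun x hx =>
    Finset.sum_eq_zero fun i hi => ho₀ i (hag hi) x fun hxi => hx (C.loop_subset hi hxi)
  have hsingle : ∀ j ∈ Finset.Icc (a + 1) g, ∀ x ∈ C.loop j,
      ∑ i ∈ Finset.Icc (a + 1) g, o i x = o j x := fun j hj x hx =>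
    Finset.sum_eq_single_of_mem j hj fun i hi hij =>
      ho₀ i (hatt hi) x fun hxi => hij (C.eq_of_mem_attached hi hj hxi hx)
  have hattached : ∀ j ∈ Finset.Icc (a + 1) g,
      o j (C.v j) ≤ 0 ∧ (j ∈ J → o j (C.v j) ≤ -2) := by
    intro j hj
    have heq : ∀ x ∈ C.loop j, x ≠ C.v j → o j x = F x + B x := fun x hx hxv => by
      have hxΓ : x ∉ C.Γ₀ := fun h => hxv (C.eq_v hj hx h)
      rw [hsum, hD₀ x hxΓ, hchain x hxΓ, hsingle j hj x hx]
      ring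
    obtain ⟨h₁, h₂⟩ := principal_coeff_le (hodeg j (hatt hj)) (hone j (hatt hj)) (v := C.v j)
      fun x hxv => by
        by_cases hx : x ∈ C.loop j
        · rw [heq x hx hxv]
          exact add_nonneg (hF x) (hB x)
        · rw [ho₀ j (hatt hj) x hx]
    refine ⟨h₁, fun hjJ => h₂ (q j) (hqv j hjJ) ?_⟩
    rw [heq _ (hql j hjJ) (hqv j hjJ)]
    linarith [hF (q j), hBq j hjJ]
  have hV : ∀ x, (∑ j ∈ J, Finsupp.single (C.v j) (2 : ℤ)) x
      = ∑ j ∈ J, if C.v j = x then 2 else 0 := fun x => by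
    rw [Finsupp.finsetSum_apply]
    simp only [Finsupp.single_apply]
  set R : Divisor C.Γ :=
    D + ∑ i ∈ Finset.Icc 1 a, o i - ∑ j ∈ J, Finsupp.single (C.v j) 2 with hR
  have hE : ∀ x, R x
      = D x + ∑ i ∈ Finset.Icc 1 a, o i x - ∑ j ∈ J, if C.v j = x then 2 else 0 := fun x => by
    rw [hR, Finsupp.sub_apply, hV, Finsupp.add_apply, Finsupp.finsetSum_apply]
  have hE₀ : ∀ x ∉ C.Γ₀,
      R x = 0 := fun x hx => by
    rw [hE, hD₀ x hx, hchain x hx, Finset.sum_eq_zero]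
    · rfl
    · intro j hj
      refine if_neg ?_
      rintro rfl
      exact hx (C.hvMem j (hJ hj))
  refine ⟨R, fun x => ?_,
    fun x hx => ?_, ?_, ?_⟩
  · by_cases hx : x ∈ C.Γ₀
    swap
    · exact (hE₀ x hx).ge
    have hx₁ : D x + ∑ i ∈ Finset.Icc 1 a, o i x
        = F x + B x - ∑ i ∈ Finset.Icc (a + 1) g, o i x := by
      rw [hsum]
      ring
    have hx₂ : ∑ j ∈ J, (if C.v j = x then (2 : ℤ) else 0)
        = ∑ j ∈ Finset.Icc (a + 1) g, if j ∈ J then (if C.v j = x then (2 : ℤ) else 0) else 0 := by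
      rw [Finset.sum_ite_mem, Finset.inter_eq_right.2 hJ]
    rw [hE, hx₁, hx₂, sub_sub, ← Finset.sum_add_distrib]
    have hle : ∑ j ∈ Finset.Icc (a + 1) g,
        (o j x + if j ∈ J then (if C.v j = x then (2 : ℤ) else 0) else 0) ≤ 0 := by
      refine Finset.sum_nonpos fun j hj => ?_
      obtain ⟨h₁, h₂⟩ := hattached j hj
      by_cases hjx : C.v j = x
      · subst hjx
        by_cases hjJ : j ∈ J
        · simpa [hjJ] using add_le_add_left (h₂ hjJ) 2
        · simpa [hjJ] using h₁
      · rw [ho₀ j (hatt hj) x fun hxj => hjx (C.eq_v hj hxj hx).symm]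
        simp [hjx]
    linarith [hF x, hB x]
  · by_contra hx₀
    exact Finsupp.mem_support_iff.1 hx (hE₀ x hx₀)
  · simp only [divDeg_eq_degree] at hodeg ⊢
    rw [hR, map_sub, map_add, map_sum, map_sum, Finset.sum_eq_zero fun i hi => hodeg i (hag hi)]
    simp [hcard, mul_comm]
  · refine ⟨fun x => f x, hf.restrict _, fun x => ?_⟩
    refine ((C.isCircleCover_restrict hφ hag).hasOrderAt_iff (f := fun x => f x)
      (fun i => hpm i (hag i.2)) (o := fun i x => o i x) (fun i t => hoφ i (hag i.2) t)
      (fun i x hx => ho₀ i (hag i.2) x hx) x _).2 ?_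
    rw [Finset.sum_coe_sort (Finset.Icc 1 a) fun i => o i (x : C.Γ), add_sub_cancel]
    simp only [DivRestrict, Finsupp.comapDomain_apply, Finsupp.add_apply, Finsupp.finsetSum_apply]
    ring

end ChainPlusLoops

/-- In the chain-plus-loops graph `Γ` : if `D'` is an effective divisor of
degree `a + 2r - 1` supported on `Γ₀` with `rk_Γ(D') ≥ r`, then there are effective
divisors `E, E'` of degree `a - 1` supported on `Γ₀` with `D'` linearly equivalent on
`Γ₀` both to `2(v_{a+1} + ⋯ + v_{a+r-1} + v_g) + E` and to
`2(v_{a+1} + ⋯ + v_{a+r-1} + v_{g-1}) + E'`. -/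
theorem statement11 (a g : ℕ) (C : ChainPlusLoops a g) (r : ℕ)
    (hr1 : 1 ≤ r) (hr2 : r + a + 2 ≤ g)
    (D' : Divisor C.Γ) (hD' : Effective D') (hs : ↑D'.support ⊆ C.Γ₀)
    (hdeg : divDeg D' = (a : ℤ) + 2 * r - 1)
    (hrank : (r : ℤ) ≤ divRank C.Γ D') :
    ∃ E E' : Divisor C.Γ,
      Effective E ∧ ↑E.support ⊆ C.Γ₀ ∧ divDeg E = (a : ℤ) - 1 ∧
      Effective E' ∧ ↑E'.support ⊆ C.Γ₀ ∧ divDeg E' = (a : ℤ) - 1 ∧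
      LinEquivOn C.Γ₀ D'
        ((∑ i ∈ Finset.Icc (a + 1) (a + r - 1), Finsupp.single (C.v i) 2)
          + Finsupp.single (C.v g) 2 + E) ∧
      LinEquivOn C.Γ₀ D'
        ((∑ i ∈ Finset.Icc (a + 1) (a + r - 1), Finsupp.single (C.v i) 2)
          + Finsupp.single (C.v (g - 1)) 2 + E') := by
  have hrank' : RankGE C.Γ D' r :=
    haveI : Nonempty C.Γ := ⟨C.v g⟩
    rankGE_of_le_divRank hr1 hrank
  have main : ∀ k ∈ Finset.Icc (g - 1) g, ∃ E : Divisor C.Γ,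
      Effective E ∧ ↑E.support ⊆ C.Γ₀ ∧ divDeg E = (a : ℤ) - 1 ∧
      LinEquivOn C.Γ₀ D' ((∑ i ∈ Finset.Icc (a + 1) (a + r - 1), Finsupp.single (C.v i) 2)
        + Finsupp.single (C.v k) 2 + E) := by
    intro k hk
    rw [Finset.mem_Icc] at hk
    have hk' : k ∉ Finset.Icc (a + 1) (a + r - 1) := by
      rw [Finset.mem_Icc]
      omega
    obtain ⟨E, hE, hEs, hEd, hlin⟩ := C.exists_linEquivOn_two_mul hs hrank'
      (J := insert k (Finset.Icc (a + 1) (a + r - 1)))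
      (fun i hi => by
        simp only [Finset.mem_insert, Finset.mem_Icc] at hi ⊢
        omega)
      (by
        rw [Finset.card_insert_of_notMem hk', Nat.card_Icc]
        omega)
    refine ⟨E, hE, hEs, by rw [hEd, hdeg]; ring, ?_⟩
    rwa [Finset.sum_insert hk', add_comm (Finsupp.single (C.v k) 2)] at hlin
  obtain ⟨E, hE, hEs, hEd, hlin⟩ := main g (Finset.mem_Icc.2 ⟨Nat.sub_le _ _, le_rfl⟩)
  obtain ⟨E', hE', hEs', hEd', hlin'⟩ := main (g - 1) (Finset.mem_Icc.2 ⟨le_rfl, Nat.sub_le _ _⟩)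
  exact ⟨E, E', hE, hEs, hEd, hE', hEs', hEd', hlin, hlin'⟩
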